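/- arXiv:2412.19012 — 2 statements merged into one kernel-verified Lean document; each statement's English description precedes it below -/
import Mathlib

section
/- Let T ≥ 2 and 1 ≤ r < T, let D ∈ ℝ^{T×T} be symmetric, and set B := −(1/2) J D∘2 J where J = I_T − (1/T)𝟙𝟙ᵀ and D∘2 is the entrywise square of D. Assume λ_r(B) > λ_{r+1}(B) and λ_r(B) ≥ 0. Then any two rank-r CMDS embeddings M, M′ ∈ ℝ^{T×r} of D are equal up to an orthogonal transformation: there exists W ∈ O(r) with M W = M′. (In particular, two dynamic networks with the same distance matrix have mirrors that agree up to an r×r orthogonal matrix.) -/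
open Matrix MeasureTheory ProbabilityTheory Filter

/-- Frobenius norm of a real matrix. -/
noncomputable def frob {m n : ℕ} (A : Matrix (Fin m) (Fin n) ℝ) : ℝ :=
  Real.sqrt (∑ i, ∑ j, (A i j) ^ 2)

/-- Euclidean norm of a vector. -/
noncomputable def vnorm {n : ℕ} (x : Fin n → ℝ) : ℝ :=
  Real.sqrt (∑ i, (x i) ^ 2)

/-- Spectral norm (operator 2-norm) of a real matrix. -/
noncomputable def spec {m n : ℕ} (A : Matrix (Fin m) (Fin n) ℝ) : ℝ :=
  sSup {r : ℝ | ∃ x : Fin n → ℝ, vnorm x ≤ 1 ∧ r = vnorm (A.mulVec x)}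

/-- Smallest singular value of a square real matrix. -/
noncomputable def sigmaMin {n : ℕ} (A : Matrix (Fin n) (Fin n) ℝ) : ℝ :=
  sInf {r : ℝ | ∃ x : Fin n → ℝ, vnorm x = 1 ∧ r = vnorm (A.mulVec x)}

/-- Procrustes distance `min_{O ∈ O(d)} ‖X O − Y‖_F`. -/
noncomputable def procDist {n d : ℕ} (X Y : Matrix (Fin n) (Fin d) ℝ) : ℝ :=
  sInf {r : ℝ | ∃ O ∈ Matrix.orthogonalGroup (Fin d) ℝ, r = frob (X * O - Y)}

/-- Distance matrix `D_{t₁,t₂} = n^{-1/2} min_{O∈O(d)} ‖X_{t₁} O − X_{t₂}‖_F`. -/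
noncomputable def distMat {n d T : ℕ} (X : Fin T → Matrix (Fin n) (Fin d) ℝ) :
    Matrix (Fin T) (Fin T) ℝ :=
  Matrix.of fun t₁ t₂ => (Real.sqrt n)⁻¹ * procDist (X t₁) (X t₂)

/-- The centering matrix `J = I − (1/T) 𝟙𝟙ᵀ`. -/
noncomputable def centerJ (T : ℕ) : Matrix (Fin T) (Fin T) ℝ :=
  1 - ((T : ℝ))⁻¹ • Matrix.of (fun _ _ => (1 : ℝ))

/-- The doubly centered matrix `B = −(1/2) J D∘2 J`. -/
noncomputable def dcB {T : ℕ} (D : Matrix (Fin T) (Fin T) ℝ) : Matrix (Fin T) (Fin T) ℝ :=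
  (-(1/2 : ℝ)) • (centerJ T * Matrix.of (fun i j => (D i j) ^ 2) * centerJ T)

/-- Maximum absolute entry of a matrix. -/
noncomputable def normMax {m n : ℕ} (A : Matrix (Fin m) (Fin n) ℝ) : ℝ := ⨆ i, ⨆ j, |A i j|

/-- `lam` lists the eigenvalues of the real symmetric matrix `B` in nonincreasing order:
it is nonincreasing and `B = V (diag lam) Vᵀ` for some orthogonal `V`. -/
def SortedDecomp {T : ℕ} (B : Matrix (Fin T) (Fin T) ℝ) (lam : Fin T → ℝ) : Prop :=
  (∀ i j : Fin T, i ≤ j → lam j ≤ lam i) ∧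
  ∃ V ∈ Matrix.orthogonalGroup (Fin T) ℝ, B = V * Matrix.diagonal lam * Vᵀ

/-- `Xh` is an adjacency spectral embedding of dimension `d` of the symmetric matrix `A`:
`Xh = Û |Λ̂|^{1/2}` where `Λ̂` contains the `d` largest eigenvalues of `A` and the columns
of `Û` are corresponding orthonormal eigenvectors. -/
def IsASE {n d : ℕ} (hdn : d ≤ n) (A : Matrix (Fin n) (Fin n) ℝ)
    (Xh : Matrix (Fin n) (Fin d) ℝ) : Prop :=
  ∃ (V : Matrix (Fin n) (Fin n) ℝ) (lam : Fin n → ℝ),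
    V ∈ Matrix.orthogonalGroup (Fin n) ℝ ∧
    (∀ i j : Fin n, i ≤ j → lam j ≤ lam i) ∧
    A = V * Matrix.diagonal lam * Vᵀ ∧
    Xh = V.submatrix id (Fin.castLE hdn) *
      Matrix.diagonal (fun k : Fin d => Real.sqrt |lam (Fin.castLE hdn k)|)

/-- Each embedding is a fixed matrix times an orthogonal matrix. -/
lemma cmds_factor (T r : ℕ) (f : Fin r → Fin T) (hf : Function.Injective f)
    (B V : Matrix (Fin T) (Fin T) ℝ) (lam : Fin T → ℝ)
    (hV : V ∈ Matrix.orthogonalGroup (Fin T) ℝ)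
    (hB : B = V * Matrix.diagonal lam * Vᵀ)
    (hgap : ∀ i, i ∉ Set.range f → ∀ k, lam i ≠ lam (f k))
    (U : Matrix (Fin T) (Fin r) ℝ) (hU : Uᵀ * U = 1)
    (hBU : B * U = U * Matrix.diagonal (fun k => lam (f k))) :
    ∃ Q ∈ Matrix.orthogonalGroup (Fin r) ℝ,
      U * Matrix.diagonal (fun k => Real.sqrt (lam (f k))) =
      V.submatrix id f * Matrix.diagonal (fun k => Real.sqrt (lam (f k))) * Q := by
  have h1 : Vᵀ * V = 1 := by
    simpa [Matrix.star_eq_conjTranspose] using (Matrix.mem_orthogonalGroup_iff' (Fin T) ℝ).1 hV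
  have h2 : V * Vᵀ = 1 := by
    simpa [Matrix.star_eq_conjTranspose] using (Matrix.mem_orthogonalGroup_iff (Fin T) ℝ).1 hV
  obtain ⟨A, hA⟩ : ∃ A, A = Vᵀ * U := ⟨_, rfl⟩
  have hUA : U = V * A := by rw [hA, ← Matrix.mul_assoc, h2, Matrix.one_mul]
  have hcomm : Matrix.diagonal lam * A = A * Matrix.diagonal (fun k => lam (f k)) := by
    have h3 : Vᵀ * (B * U) = Vᵀ * (U * Matrix.diagonal (fun k => lam (f k))) := by rw [hBU]
    rw [← Matrix.mul_assoc Vᵀ U, ← hA] at h3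
    rw [← h3, hB, hA]
    simp only [← Matrix.mul_assoc]
    rw [h1, Matrix.one_mul]
  have hz : ∀ i k, lam i ≠ lam (f k) → A i k = 0 := by
    intro i k hne
    have h4 := congrFun (congrFun hcomm i) k
    rw [Matrix.diagonal_mul, Matrix.mul_diagonal] at h4
    have h5 : (lam i - lam (f k)) * A i k = 0 := by linarith
    exact (mul_eq_zero.1 h5).resolve_left (sub_ne_zero.2 hne)
  have hAA : Aᵀ * A = 1 := by
    rw [← hU, hUA, Matrix.transpose_mul]
    simp only [Matrix.mul_assoc]
    rw [← Matrix.mul_assoc Vᵀ V, h1, Matrix.one_mul]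
  refine ⟨A.submatrix f id, ?_, ?_⟩
  · rw [Matrix.mem_orthogonalGroup_iff']
    rw [← hAA]
    ext i k
    simp only [Matrix.mul_apply,
      Matrix.transpose_apply, Matrix.submatrix_apply, id]
    refine Fintype.sum_of_injective f hf _ _ ?_ (fun _ => rfl)
    intro j hj
    rw [hz j i (hgap j hj i), zero_mul]
  · ext i k
    rw [Matrix.mul_diagonal, hUA, Matrix.mul_apply, Matrix.mul_apply, Finset.sum_mul]
    symm
    refine Fintype.sum_of_injective f hf _ _ ?_ ?_
    · intro j hj
      rw [hz j k (hgap j hj k), mul_zero, zero_mul]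
    · intro j
      rw [Matrix.mul_diagonal]
      simp only [Matrix.submatrix_apply, id]
      by_cases h : lam (f j) = lam (f k)
      · rw [h]; ring
      · rw [hz _ _ h]; ring

/-- under an eigengap `λ_r(B) > λ_{r+1}(B)` with `λ_r(B) ≥ 0`, any two rank-`r`
CMDS embeddings of a symmetric matrix `D` agree up to an orthogonal transformation. -/
theorem cmds_unique_up_to_orthogonal
    (T r : ℕ) (hT : 2 ≤ T) (hr1 : 1 ≤ r) (hrT : r < T)
    (D : Matrix (Fin T) (Fin T) ℝ) (hD : D.IsSymm)
    (lam : Fin T → ℝ)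
    (hsorted : ∀ i j : Fin T, i ≤ j → lam j ≤ lam i)
    (hdecomp : ∃ V ∈ Matrix.orthogonalGroup (Fin T) ℝ,
      dcB D = V * Matrix.diagonal lam * Vᵀ)
    (hgap : lam ⟨r, hrT⟩ < lam ⟨r - 1, by omega⟩)
    (hpos : 0 ≤ lam ⟨r - 1, by omega⟩)
    (M M' : Matrix (Fin T) (Fin r) ℝ)
    (hM : ∃ U : Matrix (Fin T) (Fin r) ℝ, Uᵀ * U = 1 ∧
      dcB D * U = U * Matrix.diagonal (fun k : Fin r => lam (Fin.castLE hrT.le k)) ∧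
      M = U * Matrix.diagonal (fun k : Fin r => Real.sqrt (lam (Fin.castLE hrT.le k))))
    (hM' : ∃ U : Matrix (Fin T) (Fin r) ℝ, Uᵀ * U = 1 ∧
      dcB D * U = U * Matrix.diagonal (fun k : Fin r => lam (Fin.castLE hrT.le k)) ∧
      M' = U * Matrix.diagonal (fun k : Fin r => Real.sqrt (lam (Fin.castLE hrT.le k)))) :
    ∃ W ∈ Matrix.orthogonalGroup (Fin r) ℝ, M * W = M' := by
  obtain ⟨V, hV, hB⟩ := hdecomp
  have hgap' : ∀ i, i ∉ Set.range (Fin.castLE hrT.le) →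
      ∀ k : Fin r, lam i ≠ lam (Fin.castLE hrT.le k) := by
    intro i hi k
    have hi' : r ≤ i.1 := by
      by_contra h
      exact hi ⟨⟨i.1, by omega⟩, by ext; simp⟩
    have a := hsorted ⟨r, hrT⟩ i (by rw [Fin.le_def]; exact hi')
    have b := hsorted (Fin.castLE hrT.le k) ⟨r - 1, by omega⟩ (by
      rw [Fin.le_def]
      have := k.2
      simp only [Fin.val_castLE]
      omega)
    exact ne_of_lt (by linarith)
  obtain ⟨U, hU, hBU, rfl⟩ := hM
  obtain ⟨U', hU', hBU', rfl⟩ := hM'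
  obtain ⟨Q, hQ, e⟩ := cmds_factor T r (Fin.castLE hrT.le) (Fin.castLE_injective _) (dcB D) V lam
    hV hB hgap' U hU hBU
  obtain ⟨Q', hQ', e'⟩ := cmds_factor T r (Fin.castLE hrT.le) (Fin.castLE_injective _) (dcB D) V lam
    hV hB hgap' U' hU' hBU'
  refine ⟨star Q * Q', mul_mem (Unitary.star_mem hQ) hQ', ?_⟩
  rw [e, e', Matrix.mul_assoc _ Q, ← Matrix.mul_assoc Q,
    Unitary.mul_star_self_of_mem hQ, Matrix.one_mul]
end

section
/- Let X, Y, X′, Y′ ∈ ℝ^{n×d} and suppose A := XᵀY is invertible. Let W be any minimizer of O ↦ ‖XO − Y‖_F over O(d) and W′ any minimizer of O ↦ ‖X′O − Y′‖_F over O(d). Then ‖W − W′‖ ≤ 2 ‖X′ᵀY′ − XᵀY‖ / σ_min(XᵀY), where ‖·‖ is the spectral norm and σ_min denotes the smallest singular value. -/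
open Matrix MeasureTheory ProbabilityTheory Filter

/-- `W` is a minimizer of `O ↦ ‖X O − Y‖_F` over the orthogonal group `O(d)`. -/
def IsProcMin {n d : ℕ} (X Y : Matrix (Fin n) (Fin d) ℝ)
    (W : Matrix (Fin d) (Fin d) ℝ) : Prop :=
  W ∈ Matrix.orthogonalGroup (Fin d) ℝ ∧
    ∀ O ∈ Matrix.orthogonalGroup (Fin d) ℝ, frob (X * W - Y) ≤ frob (X * O - Y)

lemma vnorm_eq {n : ℕ} (x : Fin n → ℝ) : vnorm x = Real.sqrt (x ⬝ᵥ x) := by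
  simp [vnorm, dotProduct, sq]

lemma dot_self_nonneg' {n : ℕ} (x : Fin n → ℝ) : 0 ≤ x ⬝ᵥ x := by
  simp only [dotProduct]; exact Finset.sum_nonneg fun i _ => mul_self_nonneg _

lemma vnorm_nonneg {n : ℕ} (x : Fin n → ℝ) : 0 ≤ vnorm x := Real.sqrt_nonneg _

lemma vnorm_sq {n : ℕ} (x : Fin n → ℝ) : vnorm x ^ 2 = x ⬝ᵥ x := by
  rw [vnorm_eq, Real.sq_sqrt (dot_self_nonneg' x)]

lemma vnorm_smul {n : ℕ} (c : ℝ) (x : Fin n → ℝ) : vnorm (c • x) = |c| * vnorm x := by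
  rw [vnorm_eq, vnorm_eq, smul_dotProduct, dotProduct_smul, smul_eq_mul, smul_eq_mul, ← mul_assoc,
    Real.sqrt_mul (mul_self_nonneg c), Real.sqrt_mul_self_eq_abs]

lemma vnorm_neg' {n : ℕ} (x : Fin n → ℝ) : vnorm (-x) = vnorm x := by
  simp [vnorm]

lemma dot_le_vnorm {n : ℕ} (x y : Fin n → ℝ) : x ⬝ᵥ y ≤ vnorm x * vnorm y := by
  simp only [dotProduct, vnorm]
  exact Real.sum_mul_le_sqrt_mul_sqrt _ _ _

lemma vnorm_eq_zero {n : ℕ} {x : Fin n → ℝ} (h : vnorm x = 0) : x = 0 := by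
  have := vnorm_sq x
  rw [h] at this
  have h2 : x ⬝ᵥ x = 0 := by rw [← this]; ring
  exact dotProduct_self_eq_zero.mp h2

lemma adj {n m : ℕ} (M : Matrix (Fin n) (Fin m) ℝ) (u : Fin n → ℝ) (v : Fin m → ℝ) :
    u ⬝ᵥ (M *ᵥ v) = (Mᵀ *ᵥ u) ⬝ᵥ v := by
  rw [dotProduct_mulVec, mulVec_transpose]

lemma vnorm_mulVec_frob {m n : ℕ} (A : Matrix (Fin m) (Fin n) ℝ) (x : Fin n → ℝ) :
    vnorm (A *ᵥ x) ≤ frob A * vnorm x := by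
  rw [frob, vnorm, vnorm, ← Real.sqrt_mul (by positivity)]
  apply Real.sqrt_le_sqrt
  rw [Finset.sum_mul]
  apply Finset.sum_le_sum
  intro i _
  simp only [mulVec, dotProduct]
  exact Finset.sum_mul_sq_le_sq_mul_sq _ _ _

lemma spec_bdd {m n : ℕ} (A : Matrix (Fin m) (Fin n) ℝ) :
    BddAbove {r : ℝ | ∃ x : Fin n → ℝ, vnorm x ≤ 1 ∧ r = vnorm (A.mulVec x)} := by
  refine ⟨frob A, ?_⟩
  rintro r ⟨x, hx, rfl⟩
  refine (vnorm_mulVec_frob A x).trans ?_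
  have : 0 ≤ frob A := Real.sqrt_nonneg _
  nlinarith

lemma spec_nonneg {m n : ℕ} (A : Matrix (Fin m) (Fin n) ℝ) : 0 ≤ spec A := by
  apply Real.sSup_nonneg
  rintro r ⟨x, hx, rfl⟩
  exact vnorm_nonneg _

lemma vnorm_mulVec_spec {m n : ℕ} (A : Matrix (Fin m) (Fin n) ℝ) (x : Fin n → ℝ) :
    vnorm (A *ᵥ x) ≤ spec A * vnorm x := by
  rcases (vnorm_nonneg x).eq_or_lt with h | h
  · rw [vnorm_eq_zero h.symm]; simp [vnorm]
  · have h1 : vnorm (A *ᵥ ((vnorm x)⁻¹ • x)) ≤ spec A := by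
      refine le_csSup (spec_bdd A) ⟨_, ?_, rfl⟩
      rw [vnorm_smul, abs_of_pos (inv_pos.mpr h), inv_mul_cancel₀ h.ne']
    rw [mulVec_smul, vnorm_smul, abs_of_pos (inv_pos.mpr h), inv_mul_le_iff₀ h] at h1
    linarith

lemma spec_le {m n : ℕ} (A : Matrix (Fin m) (Fin n) ℝ) (K : ℝ) (hK : 0 ≤ K)
    (h : ∀ x, vnorm (A *ᵥ x) ≤ K * vnorm x) : spec A ≤ K := by
  refine csSup_le ⟨vnorm (A *ᵥ 0), 0, by simp [vnorm], rfl⟩ ?_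
  rintro r ⟨x, hx, rfl⟩
  refine (h x).trans ?_
  nlinarith

lemma sigmaMin_nonneg {n : ℕ} (A : Matrix (Fin n) (Fin n) ℝ) : 0 ≤ sigmaMin A := by
  apply Real.sInf_nonneg
  rintro r ⟨x, hx, rfl⟩
  exact vnorm_nonneg _

lemma sigmaMin_mul_le {n : ℕ} (A : Matrix (Fin n) (Fin n) ℝ) (x : Fin n → ℝ) (hx : vnorm x = 1) :
    sigmaMin A ≤ vnorm (A *ᵥ x) := by
  refine csInf_le ⟨0, ?_⟩ ⟨x, hx, rfl⟩
  rintro r ⟨x, hx, rfl⟩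
  exact vnorm_nonneg _

lemma sigmaMin_pos {n : ℕ} (hn : 0 < n) (A : Matrix (Fin n) (Fin n) ℝ) (hA : IsUnit A) :
    0 < sigmaMin A := by
  obtain ⟨B, hB⟩ := hA.exists_left_inv
  have hs := spec_nonneg B
  have : 1 / (spec B + 1) ≤ sigmaMin A := by
    apply le_csInf
    · refine ⟨_, Pi.single ⟨0, hn⟩ 1, ?_, rfl⟩
      rw [vnorm_eq]; simp
    · rintro r ⟨x, hx, rfl⟩
      have h1 := vnorm_mulVec_spec B (A *ᵥ x)
      rw [mulVec_mulVec, hB, one_mulVec, hx] at h1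
      rw [div_le_iff₀ (by positivity)]
      nlinarith [vnorm_nonneg (A *ᵥ x)]
  exact lt_of_lt_of_le (by positivity) this

lemma eig_crit {n : ℕ} (M : Matrix (Fin n) (Fin n) ℝ) (hM : Mᵀ = M)
    (h : ∀ (l : ℝ) (x : Fin n → ℝ), vnorm x = 1 → M *ᵥ x = l • x → 0 ≤ l) (u : Fin n → ℝ) :
    0 ≤ u ⬝ᵥ (M *ᵥ u) := by
  have hH : M.IsHermitian := by rw [Matrix.IsHermitian, conjTranspose_eq_transpose_of_trivial, hM]
  have : M.PosSemidef := by
    rw [hH.posSemidef_iff_eigenvalues_nonneg]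
    intro i
    refine h _ (hH.eigenvectorBasis i) ?_ (hH.mulVec_eigenvectorBasis i)
    have := hH.eigenvectorBasis.orthonormal.1 i
    rw [EuclideanSpace.norm_eq] at this
    simpa [vnorm] using this
  simpa using this.dotProduct_mulVec_nonneg u

lemma trace_vecMulVec_mul {n : ℕ} (u v : Fin n → ℝ) (H : Matrix (Fin n) (Fin n) ℝ) :
    trace (vecMulVec u v * H) = v ⬝ᵥ (H *ᵥ u) := by
  rw [vecMulVec_mul, trace_vecMulVec, dotProduct_comm, dotProduct_mulVec]

/-- reflection -/
def refl' {n : ℕ} (u : Fin n → ℝ) : Matrix (Fin n) (Fin n) ℝ := 1 - (2:ℝ) • vecMulVec u u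

lemma refl_mem {n : ℕ} (u : Fin n → ℝ) (hu : u ⬝ᵥ u = 1) :
    refl' u ∈ Matrix.orthogonalGroup (Fin n) ℝ := by
  rw [Matrix.mem_orthogonalGroup_iff]
  simp only [refl', star_eq_conjTranspose, conjTranspose_eq_transpose_of_trivial, transpose_sub,
    transpose_one, transpose_smul, transpose_vecMulVec]
  simp only [sub_mul, mul_sub, one_mul, mul_one, smul_mul_assoc, mul_smul_comm,
    vecMulVec_mul_vecMulVec, hu, one_smul]
  module

lemma psd_of_max {n : ℕ} (H : Matrix (Fin n) (Fin n) ℝ)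
    (h : ∀ Q ∈ Matrix.orthogonalGroup (Fin n) ℝ, trace (Q * H) ≤ trace H) (u : Fin n → ℝ) :
    0 ≤ u ⬝ᵥ (H *ᵥ u) := by
  rcases (vnorm_nonneg u).eq_or_lt with h0 | h0
  · rw [vnorm_eq_zero h0.symm]; simp
  have h1 := h (refl' ((vnorm u)⁻¹ • u)) (refl_mem _ (by
    rw [smul_dotProduct, dotProduct_smul, ← vnorm_sq]; simp only [smul_eq_mul]; field_simp))
  simp only [refl', sub_mul, one_mul, trace_sub, smul_mul_assoc, trace_smul, trace_vecMulVec_mul,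
    mulVec_smul, smul_dotProduct, dotProduct_smul, smul_eq_mul] at h1
  have : 0 ≤ (vnorm u)⁻¹ * ((vnorm u)⁻¹ * u ⬝ᵥ (H *ᵥ u)) := by linarith
  have h2 : 0 < (vnorm u)⁻¹ := inv_pos.mpr h0
  exact nonneg_of_mul_nonneg_right (nonneg_of_mul_nonneg_right this h2) h2

lemma two_refl {n : ℕ} (H : Matrix (Fin n) (Fin n) ℝ)
    (h : ∀ Q ∈ Matrix.orthogonalGroup (Fin n) ℝ, trace (Q * H) ≤ trace H) (u v : Fin n → ℝ)
    (hu : u ⬝ᵥ u = 1) (hv : v ⬝ᵥ v = 1) :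
    2 * (u ⬝ᵥ v) * (v ⬝ᵥ (H *ᵥ u)) ≤ u ⬝ᵥ (H *ᵥ u) + v ⬝ᵥ (H *ᵥ v) := by
  have h1 := h _ (mul_mem (refl_mem u hu) (refl_mem v hv))
  simp only [refl', sub_mul, mul_sub, one_mul, mul_one, trace_sub, smul_mul_assoc, mul_smul_comm,
    trace_smul, trace_vecMulVec_mul, smul_eq_mul, vecMulVec_mul_vecMulVec,
    smul_dotProduct, dotProduct_smul] at h1
  linarith

lemma symm_of_max {n : ℕ} (H : Matrix (Fin n) (Fin n) ℝ)
    (h : ∀ Q ∈ Matrix.orthogonalGroup (Fin n) ℝ, trace (Q * H) ≤ trace H) : Hᵀ = H := by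
  have key : ∀ i j, i ≠ j → H j i ≤ H i j := by
    intro i j hij
    by_contra! hlt
    have ha : 0 ≤ H i i := by simpa using psd_of_max H h (Pi.single i 1)
    have hb : 0 ≤ H j j := by simpa using psd_of_max H h (Pi.single j 1)
    set a := H i i with hha
    set b := H j j with hhb
    set p := H i j with hp
    set q := H j i with hq
    set r := Real.sqrt ((a + b + 1)^2 + (q-p)^2) with hr
    have hr2 : r ^ 2 = (a + b + 1)^2 + (q-p)^2 := Real.sq_sqrt (by positivity)
    have hrpos : 0 < r := Real.sqrt_pos.mpr (by positivity)
    set c := (a + b + 1) / r with hc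
    set s := (q - p) / r with hs
    have hcs : c * c + s * s = 1 := by
      rw [hc, hs]; field_simp; linarith
    have hspos : 0 < s := div_pos (by linarith) hrpos
    have h1 := two_refl H h (Pi.single i 1) (c • Pi.single i 1 + s • Pi.single j 1) (by simp) (by
      simp [hij, hij.symm, hcs])
    simp [hij, hij.symm, mulVec_add, mulVec_smul, ← hha, ← hhb, ← hp, ← hq] at h1
    have h2 : s * (c * (q - p)) ≤ s * (s * (a + b)) := by
      have e : s * s = 1 - c * c := by linarith
      nlinarith
    have h3 := le_of_mul_le_mul_left h2 hspos
    have h4 : c * (q-p) = s * (a + b + 1) := by rw [hc, hs]; ring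
    nlinarith
  ext i j
  rw [transpose_apply]
  by_cases hij : i = j
  · rw [hij]
  · exact le_antisymm (key i j hij) (key j i (Ne.symm hij))

lemma frob_sq {m n : ℕ} (A : Matrix (Fin m) (Fin n) ℝ) : frob A ^ 2 = trace (Aᵀ * A) := by
  rw [frob, Real.sq_sqrt (by positivity), Finset.sum_comm]
  simp [trace, mul_apply, sq]

lemma frob_expand {n d : ℕ} (X Y : Matrix (Fin n) (Fin d) ℝ) (O : Matrix (Fin d) (Fin d) ℝ)
    (hO : O ∈ Matrix.orthogonalGroup (Fin d) ℝ) :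
    frob (X * O - Y) ^ 2 = trace (Xᵀ * X) + trace (Yᵀ * Y) - 2 * trace (Oᵀ * (Xᵀ * Y)) := by
  have hO' : O * Oᵀ = 1 := by
    simpa [star_eq_conjTranspose] using Matrix.mem_orthogonalGroup_iff _ _ |>.mp hO
  rw [frob_sq]
  simp only [transpose_sub, transpose_mul, Matrix.sub_mul, Matrix.mul_sub, trace_sub]
  have e1 : trace (Oᵀ * Xᵀ * (X * O)) = trace (Xᵀ * X) := by
    rw [trace_mul_comm, show X * O * (Oᵀ * Xᵀ) = X * (O * Oᵀ) * Xᵀ by simp only [Matrix.mul_assoc],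
      hO', Matrix.mul_one, trace_mul_comm]
  have e2 : trace (Yᵀ * (X * O)) = trace (Oᵀ * Xᵀ * Y) := by
    rw [← trace_transpose]; simp only [transpose_mul, transpose_transpose]
  rw [e1, e2, Matrix.mul_assoc]
  ring

lemma max_of_min {n d : ℕ} (X Y : Matrix (Fin n) (Fin d) ℝ) (W : Matrix (Fin d) (Fin d) ℝ)
    (hW : IsProcMin X Y W) (Q : Matrix (Fin d) (Fin d) ℝ)
    (hQ : Q ∈ Matrix.orthogonalGroup (Fin d) ℝ) :
    trace (Q * (Wᵀ * (Xᵀ * Y))) ≤ trace (Wᵀ * (Xᵀ * Y)) := by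
  have hm : W * Qᵀ ∈ Matrix.orthogonalGroup (Fin d) ℝ := by
    refine mul_mem hW.1 ?_
    have := Unitary.star_mem hQ
    simpa [star_eq_conjTranspose] using this
  have h1 := hW.2 _ hm
  have h2 : frob (X * W - Y) ^ 2 ≤ frob (X * (W * Qᵀ) - Y) ^ 2 :=
    pow_le_pow_left₀ (Real.sqrt_nonneg _) h1 2
  rw [frob_expand X Y W hW.1, frob_expand X Y _ hm, transpose_mul, transpose_transpose,
    Matrix.mul_assoc] at h2
  linarith

lemma core {d : ℕ} (Q H H' E : Matrix (Fin d) (Fin d) ℝ) (hQ : Qᵀ * Q = 1) (σ e : ℝ)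
    (hσ : 0 < σ) (hH : Hᵀ = H) (hHσ : ∀ u, σ * (u ⬝ᵥ u) ≤ u ⬝ᵥ (H *ᵥ u))
    (hH' : H'ᵀ = H') (hH'0 : ∀ u, 0 ≤ u ⬝ᵥ (H' *ᵥ u)) (hE : E = Q * H' - H)
    (hEe : ∀ u v, u ⬝ᵥ (E *ᵥ v) ≤ e * (vnorm u * vnorm v))
    (x : Fin d → ℝ) (hx : x ⬝ᵥ x = 1) (c : ℝ) (hc : Q *ᵥ x + Qᵀ *ᵥ x = (2 * c) • x) :
    2 - 2 * c ≤ (2 * e / σ) ^ 2 := by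
  have hQQ : ∀ v, Qᵀ *ᵥ (Q *ᵥ v) = v := fun v => by rw [mulVec_mulVec, hQ, one_mulVec]
  have hQQ' : ∀ v, Q *ᵥ (Qᵀ *ᵥ v) = v := fun v => by
    rw [mulVec_mulVec, mul_eq_one_comm.mp hQ, one_mulVec]
  have hEuv : ∀ u v, u ⬝ᵥ (E *ᵥ v) = (Qᵀ *ᵥ u) ⬝ᵥ (H' *ᵥ v) - u ⬝ᵥ (H *ᵥ v) := fun u v => by
    rw [hE, sub_mulVec, dotProduct_sub, ← mulVec_mulVec, adj]
  have hHs : ∀ u v, u ⬝ᵥ (H *ᵥ v) = v ⬝ᵥ (H *ᵥ u) := fun u v => by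
    rw [adj, hH, dotProduct_comm]
  have hHs' : ∀ u v, u ⬝ᵥ (H' *ᵥ v) = v ⬝ᵥ (H' *ᵥ u) := fun u v => by
    rw [adj, hH', dotProduct_comm]
  have hQd : ∀ v, (Q *ᵥ v) ⬝ᵥ (Q *ᵥ v) = v ⬝ᵥ v := fun v => by rw [adj, hQQ]
  have hQn : ∀ v, vnorm (Q *ᵥ v) = vnorm v := fun v => by rw [vnorm_eq, vnorm_eq, hQd]
  have hxn : vnorm x = 1 := by rw [vnorm_eq, hx, Real.sqrt_one]
  obtain ⟨z, hz⟩ : ∃ z, z = Q *ᵥ x - c • x := ⟨_, rfl⟩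
  have hQx : Q *ᵥ x = c • x + z := by rw [hz]; module
  have hQtx : Qᵀ *ᵥ x = c • x - z := by
    rw [hz, eq_sub_of_add_eq' hc]; module
  have hQtz : Qᵀ *ᵥ z = (1 - c ^ 2) • x + c • z := by
    rw [hz, mulVec_sub, mulVec_smul, hQQ, hQtx, hz]; module
  have hQz : Q *ᵥ z = (-(1 - c ^ 2)) • x + c • z := by
    have : z = c • x - Qᵀ *ᵥ x := by rw [hQtx]; module
    nth_rewrite 1 [this]
    rw [mulVec_sub, mulVec_smul, hQQ', hQx]; module
  have hxz : x ⬝ᵥ z = 0 := by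
    have h1 : x ⬝ᵥ (Q *ᵥ x) = x ⬝ᵥ (Qᵀ *ᵥ x) := by
      rw [adj, dotProduct_comm]
    rw [hQx, hQtx, dotProduct_add, dotProduct_sub] at h1
    linarith
  have hzz : z ⬝ᵥ z = 1 - c ^ 2 := by
    have := hQd x
    rw [hQx, hx, add_dotProduct, dotProduct_add, dotProduct_add, dotProduct_comm z (c • x)] at this
    simp only [smul_dotProduct, dotProduct_smul, hxz, hx, smul_eq_mul] at this
    linarith
  obtain ⟨s, hs⟩ : ∃ s, s = vnorm z := ⟨_, rfl⟩
  have hs0 : 0 ≤ s := hs ▸ vnorm_nonneg z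
  have hs2 : s ^ 2 = 1 - c ^ 2 := by rw [hs, vnorm_sq, hzz]
  rw [← hs2] at hQtz hQz hzz
  rw [div_pow, le_div_iff₀ (by positivity)]
  have hcle : c ^ 2 ≤ 1 := by nlinarith
  have hc1 : c ≤ 1 := by nlinarith
  have hc2 : -1 ≤ c := by nlinarith
  have hxH := hHσ x
  have hzH := hHσ z
  rw [hx] at hxH
  rw [hzz] at hzH
  have hxH' := hH'0 x
  have hzH' := hH'0 z
  by_cases hc0 : c ≤ 0
  · have hσe : σ ≤ e := by
      have b1 := hEe (-x) x
      have b2 := hEe (-z) z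
      rw [vnorm_neg', neg_dotProduct, hEuv, hQtx, hxn] at b1
      rw [vnorm_neg', neg_dotProduct, hEuv, hQtz, ← hs] at b2
      simp only [add_dotProduct, sub_dotProduct, smul_dotProduct, smul_eq_mul] at b1 b2
      rcases hs0.eq_or_lt with h0 | h0
      · have hz0 : z = 0 := vnorm_eq_zero (by rw [← hs, ← h0])
        rw [hz0] at b1
        simp only [zero_dotProduct] at b1
        nlinarith [mul_nonneg (neg_nonneg.mpr hc0) hxH']
      · rw [hHs' x z] at b2
        have k : s ^ 2 * (2 * σ) ≤ s ^ 2 * (2 * e) := by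
          have t1 := mul_nonneg (neg_nonneg.mpr hc0) hxH'
          have t2 := mul_nonneg (neg_nonneg.mpr hc0) hzH'
          have t3 := mul_nonneg (sq_nonneg s) t1
          have t4 := mul_le_mul_of_nonneg_left b1 (sq_nonneg s)
          have t5 := mul_le_mul_of_nonneg_left hxH (sq_nonneg s)
          nlinarith
        have := le_of_mul_le_mul_left k (by positivity)
        linarith
    nlinarith
  · push Not at hc0
    have hse : s * σ ≤ e ∨ s = 0 := by
      rcases hs0.eq_or_lt with h0 | h0
      · right; exact h0.symm
      left
      have b1 := hEe (Q *ᵥ z) x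
      have b2 := hEe (-(Q *ᵥ x)) z
      rw [hQn, hEuv, hQQ, hxn, hQz, ← hs] at b1
      rw [vnorm_neg', neg_dotProduct, hEuv, hQQ, hQn, hQx, ← hs, hxn] at b2
      simp only [add_dotProduct, smul_dotProduct, smul_eq_mul] at b1 b2
      rw [hHs' x z, hHs x z] at b2
      have t5 := mul_le_mul_of_nonneg_left hxH (sq_nonneg s)
      have k : s * (2 * (s * σ)) ≤ s * (2 * e) := by nlinarith
      have := le_of_mul_le_mul_left k h0
      linarith
    rcases hse with h | h
    · have h1 : (s * σ) ^ 2 ≤ e ^ 2 := pow_le_pow_left₀ (by positivity) h 2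
      have h2 : 1 - c ≤ s ^ 2 := by nlinarith
      have h3 := mul_le_mul_of_nonneg_right h2 (sq_nonneg σ)
      nlinarith [mul_nonneg (sub_nonneg.mpr hc1) (sq_nonneg σ)]
    · have : c = 1 := by
        rw [h] at hs2
        nlinarith
      rw [this]; nlinarith [sq_nonneg (2 * e)]

/-- perturbation bound for solutions of orthogonal Procrustes problems. -/
theorem procrustes_solution_perturbation
    (n d : ℕ) (X Y X' Y' : Matrix (Fin n) (Fin d) ℝ)
    (hA : IsUnit (Xᵀ * Y))
    (W W' : Matrix (Fin d) (Fin d) ℝ)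
    (hW : IsProcMin X Y W) (hW' : IsProcMin X' Y' W') :
    spec (W - W') ≤ 2 * spec (X'ᵀ * Y' - Xᵀ * Y) / sigmaMin (Xᵀ * Y) := by
  have ht0 : 0 ≤ 2 * spec (X'ᵀ * Y' - Xᵀ * Y) / sigmaMin (Xᵀ * Y) :=
    div_nonneg (mul_nonneg zero_le_two (spec_nonneg _)) (sigmaMin_nonneg _)
  apply spec_le _ _ ht0
  rcases Nat.eq_zero_or_pos d with hd | hd
  · subst hd; intro x; simp [vnorm]
  have hσ := sigmaMin_pos hd _ hA
  have hmax := max_of_min X Y W hW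
  have hmax' := max_of_min X' Y' W' hW'
  have hs := symm_of_max _ hmax
  have hp := psd_of_max _ hmax
  have hs' := symm_of_max _ hmax'
  have hp' := psd_of_max _ hmax'
  have hw1 : Wᵀ * W = 1 := by
    simpa [star_eq_conjTranspose] using (Matrix.mem_orthogonalGroup_iff' _ _).mp hW.1
  have hw2 : W * Wᵀ = 1 := mul_eq_one_comm.mp hw1
  have hw1' : W'ᵀ * W' = 1 := by
    simpa [star_eq_conjTranspose] using (Matrix.mem_orthogonalGroup_iff' _ _).mp hW'.1
  have hw2' : W' * W'ᵀ = 1 := mul_eq_one_comm.mp hw1'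
  set A := Xᵀ * Y
  set A' := X'ᵀ * Y'
  set t := 2 * spec (A' - A) / sigmaMin A with ht
  have hWn : ∀ v, vnorm (W *ᵥ v) = vnorm v := fun v => by
    rw [vnorm_eq, vnorm_eq, adj, mulVec_mulVec, hw1, one_mulVec]
  have hWtn : ∀ v, vnorm (Wᵀ *ᵥ v) = vnorm v := fun v => by
    rw [← hWn, mulVec_mulVec, hw2, one_mulVec]
  have hHσ : ∀ u, sigmaMin A * (u ⬝ᵥ u) ≤ u ⬝ᵥ ((Wᵀ * A) *ᵥ u) := by
    intro u
    have := eig_crit (Wᵀ * A - sigmaMin A • 1) (by rw [transpose_sub, hs]; simp) (by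
      intro l x hx hl
      rw [sub_mulVec, smul_mulVec, one_mulVec] at hl
      have hl' : (Wᵀ * A) *ᵥ x = (l + sigmaMin A) • x := by
        rw [eq_add_of_sub_eq hl]; module
      have h1 := hp x
      rw [hl', dotProduct_smul, ← vnorm_sq, hx] at h1
      have h2 : vnorm ((Wᵀ * A) *ᵥ x) = vnorm (A *ᵥ x) := by rw [← mulVec_mulVec, hWtn]
      have h3 := sigmaMin_mul_le A x hx
      simp only [smul_eq_mul] at h1
      rw [← h2, hl', vnorm_smul, hx, abs_of_nonneg (by linarith)] at h3
      linarith) u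
    rw [sub_mulVec, smul_mulVec, one_mulVec, dotProduct_sub, dotProduct_smul, smul_eq_mul] at this
    linarith
  have hE : Wᵀ * (A' - A) = (Wᵀ * W') * (W'ᵀ * A') - Wᵀ * A := by
    rw [show Wᵀ * W' * (W'ᵀ * A') = Wᵀ * ((W' * W'ᵀ) * A') by simp only [Matrix.mul_assoc], hw2',
      Matrix.one_mul, Matrix.mul_sub]
  have hEe : ∀ u v, u ⬝ᵥ ((Wᵀ * (A' - A)) *ᵥ v) ≤ spec (A' - A) * (vnorm u * vnorm v) := by
    intro u v
    refine (dot_le_vnorm _ _).trans ?_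
    rw [← mulVec_mulVec, hWtn]
    have := mul_le_mul_of_nonneg_left (vnorm_mulVec_spec (A' - A) v) (vnorm_nonneg u)
    linarith
  have hQ : (Wᵀ * W')ᵀ * (Wᵀ * W') = 1 := by
    rw [transpose_mul, transpose_transpose,
      show W'ᵀ * W * (Wᵀ * W') = W'ᵀ * ((W * Wᵀ) * W') by simp only [Matrix.mul_assoc], hw2,
      Matrix.one_mul, hw1']
  intro u
  have hfin := eig_crit ((t ^ 2 - 2) • 1 + (Wᵀ * W' + (Wᵀ * W')ᵀ))
    (by simp [transpose_add, add_comm]) (by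
      intro l x hx hl
      rw [add_mulVec, smul_mulVec, one_mulVec, add_mulVec] at hl
      have := core (Wᵀ * W') (Wᵀ * A) (W'ᵀ * A') _ hQ (sigmaMin A) (spec (A' - A)) hσ hs hHσ hs' hp'
        hE hEe x (by rw [← vnorm_sq, hx]; norm_num) ((l + 2 - t ^ 2) / 2) (by
          rw [eq_sub_of_add_eq' hl]; module)
      rw [← ht] at this
      linarith) u
  have hsq : vnorm ((W - W') *ᵥ u) ^ 2 ≤ (t * vnorm u) ^ 2 := by
    rw [mul_pow, vnorm_sq, vnorm_sq]
    have e1 : (W *ᵥ u) ⬝ᵥ (W *ᵥ u) = u ⬝ᵥ u := by rw [adj, mulVec_mulVec, hw1, one_mulVec]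
    have e2 : (W' *ᵥ u) ⬝ᵥ (W' *ᵥ u) = u ⬝ᵥ u := by rw [adj, mulVec_mulVec, hw1', one_mulVec]
    have e3 : u ⬝ᵥ ((Wᵀ * W') *ᵥ u) = (W *ᵥ u) ⬝ᵥ (W' *ᵥ u) := by
      rw [← mulVec_mulVec, adj, transpose_transpose]
    have e4 : u ⬝ᵥ ((Wᵀ * W')ᵀ *ᵥ u) = (W *ᵥ u) ⬝ᵥ (W' *ᵥ u) := by
      rw [adj, transpose_transpose, dotProduct_comm, e3]
    rw [add_mulVec, smul_mulVec, one_mulVec, add_mulVec, dotProduct_add, dotProduct_add,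
      dotProduct_smul, e3, e4, smul_eq_mul] at hfin
    rw [sub_mulVec, sub_dotProduct, dotProduct_sub, dotProduct_sub, e1, e2,
      dotProduct_comm (W' *ᵥ u) (W *ᵥ u)]
    linarith
  exact (pow_le_pow_iff_left₀ (vnorm_nonneg _) (mul_nonneg ht0 (vnorm_nonneg u)) two_ne_zero).mp hsq
end
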